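/- Let a < 0, b real, p real, and define r(u) = √(-a/2), f(u) = -(2b/a)u, g(u) = p·e^{-2√(-2a)u} - (b²/a²)u. Then r' = 2r² + a, r²f' = b, b²/r³ + 4rg' + g'' = 0, and b²/r(u)² - 2a·g'(u) = 4a√(-2a)·p·e^{-2√(-2a)u}. -/

import Mathlib

/-- For `a < 0`, the singular-type data `r(u) = √(-a/2)`, `f(u) = -(2b/a)u`,
`g(u) = p·e^{-2√(-2a)u} - (b²/a²)u` satisfy `r' = 2r² + a`, `r²f' = b`,
`b²/r³ + 4rg' + g'' = 0`, and `b²/r(u)² - 2a·g'(u) = 4a√(-2a)·p·e^{-2√(-2a)u}`. -/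
theorem stmt12 (a b p : ℝ) (ha : a < 0)
    (r f g : ℝ → ℝ)
    (hr : ∀ u, r u = Real.sqrt (-a / 2))
    (hf : ∀ u, f u = -(2 * b / a) * u)
    (hg : ∀ u, g u = p * Real.exp (-2 * Real.sqrt (-2 * a) * u) - (b ^ 2 / a ^ 2) * u) :
    ∀ u : ℝ,
      deriv r u = 2 * (r u) ^ 2 + a ∧
      (r u) ^ 2 * deriv f u = b ∧
      b ^ 2 / (r u) ^ 3 + 4 * r u * deriv g u + deriv (deriv g) u = 0 ∧
      b ^ 2 / (r u) ^ 2 - 2 * a * deriv g u =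
        4 * a * Real.sqrt (-2 * a) * p * Real.exp (-2 * Real.sqrt (-2 * a) * u) := by
  obtain ⟨R, hR, rfl⟩ : ∃ R : ℝ, 0 < R ∧ a = -2 * R ^ 2 := by
    refine ⟨Real.sqrt (-a / 2), Real.sqrt_pos.2 (by linarith), ?_⟩
    rw [Real.sq_sqrt (by linarith)]
    ring
  have h1 : Real.sqrt (-(-2 * R ^ 2) / 2) = R := by
    rw [show -(-2 * R ^ 2) / 2 = R ^ 2 by ring, Real.sqrt_sq hR.le]
  have h2 : Real.sqrt (-2 * (-2 * R ^ 2)) = 2 * R := by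
    rw [show -2 * (-2 * R ^ 2) = (2 * R) ^ 2 by ring, Real.sqrt_sq (by linarith)]
  rw [h1] at hr
  rw [h2] at hg ⊢
  have hE : ∀ u : ℝ, HasDerivAt (fun u => Real.exp (-2 * (2 * R) * u))
      (Real.exp (-2 * (2 * R) * u) * (-2 * (2 * R) * 1)) u := fun u =>
    ((hasDerivAt_id u).const_mul (-2 * (2 * R))).exp
  have hg1 : deriv g = fun u => p * (Real.exp (-2 * (2 * R) * u) * (-2 * (2 * R) * 1))
      - (b ^ 2 / (-2 * R ^ 2) ^ 2) * 1 := by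
    funext u
    rw [funext hg]
    exact (((hE u).const_mul p).sub ((hasDerivAt_id u).const_mul _)).deriv
  have hg2 : ∀ u, deriv (deriv g) u =
      p * (Real.exp (-2 * (2 * R) * u) * (-2 * (2 * R) * 1) * (-2 * (2 * R) * 1)) := by
    intro u
    rw [hg1]
    exact ((((hE u).mul_const _).const_mul p).sub_const _).deriv
  have hf1 : ∀ u, deriv f u = -(2 * b / (-2 * R ^ 2)) * 1 := by
    intro u
    rw [funext hf]
    exact ((hasDerivAt_id u).const_mul _).deriv
  have hr1 : ∀ u, deriv r u = 0 := by
    intro u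
    rw [funext hr]
    exact deriv_const u R
  intro u
  rw [hr1, hf1, hg2, hg1, hr]
  have hR0 : R ≠ 0 := hR.ne'
  beta_reduce
  generalize Real.exp (-2 * (2 * R) * u) = E
  refine ⟨by ring, ?_, ?_, ?_⟩
  · field_simp
  · field_simp
    ring
  · field_simp
    ring
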